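/- In the setup of Lemma 4.2 (near-geodesic bigon Θ in Y from x₁ = Hg to x₂ = Hf with d_X-shortest coset representatives g, f, labels w, u, elements h₁, h₂ ∈ H with h₁gw̄ = f = h₂gū, h = h₁⁻¹h₂, f' = gw̄, geodesics σ = [g,hg], α = [g,f'], β = [hg,f'] in X, and c the inscribed-triple point of the triangle [1,g] ∪ σ ∪ [1,hg] on σ), let p be the point of the inscribed triple of the triangle Δ₂ = σ ∪ α ∪ β lying on σ, and let K₂ = K₂(H) be the constant of Lemma 4.2. Then there is an integer constant K₃ = K₃(H) > 0 such that either d_X(g, hg) ≤ K₃ or d_X(p, c) ≤ K₂. -/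

import Mathlib

/-! ## Words over a marked generating set and word metrics -/

/-- Evaluation of a word in the letters `A × Bool` (a letter together with a sign,
`true` = the letter itself, `false` = its inverse) under a marking `π : A → G`. -/
def evalWord {A G : Type*} [Group G] (π : A → G) (w : List (A × Bool)) : G :=
  (w.map fun p => if p.2 then π p.1 else (π p.1)⁻¹).prod

/-- The word length `|g|_X` of `g ∈ G` with respect to the marked generating set `π : A → G`. -/
noncomputable def wordLen {A G : Type*} [Group G] (π : A → G) (g : G) : ℕ :=
  sInf {n | ∃ w : List (A × Bool), w.length = n ∧ evalWord π w = g}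

/-- The word metric `d_X` on the Cayley graph `X = Γ(G,A)` (restricted to vertices). -/
noncomputable def dX {A G : Type*} [Group G] (π : A → G) (g₁ g₂ : G) : ℕ :=
  wordLen π (g₁⁻¹ * g₂)

/-! ## Discrete geodesics, paths, near-geodesics, thinness, trimness -/

/-- A (discrete) geodesic from `x` to `y` in a graph-like metric `d`:
a sequence of vertices `γ 0 = x, …, γ (d x y) = y` with `d (γ i) (γ j) = |i - j|`. -/
def IsDiscGeodesic {X : Type*} (d : X → X → ℕ) (x y : X) (γ : ℕ → X) : Prop :=
  γ 0 = x ∧ γ (d x y) = y ∧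
    ∀ i j, i ≤ d x y → j ≤ d x y → d (γ i) (γ j) = Nat.dist i j

/-- A discrete edge-path of length `n`: consecutive vertices at distance at most `1`. -/
def IsDiscPath {X : Type*} (d : X → X → ℕ) (γ : ℕ → X) (n : ℕ) : Prop :=
  ∀ i < n, d (γ i) (γ (i + 1)) ≤ 1

/-- A near-geodesic from `x` to `y`: a path `p₁ p' p₂` where `p'` is geodesic and the
initial and terminal segments `p₁, p₂` have length at most `1`. -/
def IsNearGeodesicPath {X : Type*} (d : X → X → ℕ) (x y : X) (γ : ℕ → X) (n : ℕ) : Prop :=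
  γ 0 = x ∧ γ n = y ∧ IsDiscPath d γ n ∧
    ∃ a b : ℕ, a ≤ 1 ∧ b ≤ 1 ∧ a + b ≤ n ∧
      ∀ i j, a ≤ i → i ≤ j → j + b ≤ n → d (γ i) (γ j) = j - i

/-- All geodesic triangles of `(X,d)` are `δ`-thin: every side is contained in the closed
`δ`-neighbourhood of the union of the other two sides. -/
def DiscThinTriangles {X : Type*} (d : X → X → ℕ) (δ : ℝ) : Prop :=
  ∀ x y z (γ₁ γ₂ γ₃ : ℕ → X),
    IsDiscGeodesic d x y γ₁ → IsDiscGeodesic d y z γ₂ → IsDiscGeodesic d z x γ₃ →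
    ∀ i ≤ d x y, ∃ j,
      (j ≤ d y z ∧ (d (γ₁ i) (γ₂ j) : ℝ) ≤ δ) ∨
      (j ≤ d z x ∧ (d (γ₁ i) (γ₃ j) : ℝ) ≤ δ)

/-- All geodesic bigons of `(X,d)` are `δ`-thin: each side is contained in the closed
`δ`-neighbourhood of the other. -/
def DiscThinBigons {X : Type*} (d : X → X → ℕ) (δ : ℝ) : Prop :=
  ∀ x y (α β : ℕ → X), IsDiscGeodesic d x y α → IsDiscGeodesic d x y β →
    (∀ i ≤ d x y, ∃ j ≤ d x y, (d (α i) (β j) : ℝ) ≤ δ) ∧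
    (∀ i ≤ d x y, ∃ j ≤ d x y, (d (β i) (α j) : ℝ) ≤ δ)

/-- The Gromov product `(x,y)_z` with respect to the `ℕ`-valued metric `d`. -/
noncomputable def gromovProd {X : Type*} (d : X → X → ℕ) (x y z : X) : ℝ :=
  ((d z x : ℝ) + (d z y : ℝ) - (d x y : ℝ)) / 2

/-- All geodesic triangles of `(X,d)` are `δ`-trim: two points on two sides which are at the
same distance, at most the Gromov product `(x,y)_z`, from the common vertex `z`, are
`δ`-close (this is required for every labelling of the vertices of the triangle). -/
def DiscTrimTriangles {X : Type*} (d : X → X → ℕ) (δ : ℕ) : Prop :=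
  ∀ x y z (γ₁ γ₂ : ℕ → X), IsDiscGeodesic d z x γ₁ → IsDiscGeodesic d z y γ₂ →
    ∀ i, i ≤ d z x → i ≤ d z y → (i : ℝ) ≤ gromovProd d x y z →
      d (γ₁ i) (γ₂ i) ≤ δ

/-- `S ⊆ G` is `C`-quasiconvex w.r.t. `d`: every geodesic with endpoints in `S`
stays in the closed `C`-neighbourhood of `S`. -/
def DiscQuasiconvex {G : Type*} (d : G → G → ℕ) (S : Set G) (C : ℝ) : Prop :=
  ∀ x y (γ : ℕ → G), x ∈ S → y ∈ S → IsDiscGeodesic d x y γ →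
    ∀ i ≤ d x y, ∃ h ∈ S, (d (γ i) h : ℝ) ≤ C

/-! ## The relative Cayley graph (Schreier coset graph) -/

/-- The right coset `Hg` of `g`, as a vertex of the relative Cayley graph `Γ(G/H,A)`. -/
def rcoset {G : Type*} [Group G] (H : Subgroup G) (g : G) :
    Quotient (QuotientGroup.rightRel H) :=
  Quotient.mk (QuotientGroup.rightRel H) g

/-- Right multiplication `Hg ↦ Hga` on right cosets; this is the map tracing the
edges of the relative Cayley graph. -/
def cosetMul {G : Type*} [Group G] (H : Subgroup G)
    (x : Quotient (QuotientGroup.rightRel H)) (g : G) :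
    Quotient (QuotientGroup.rightRel H) :=
  Quotient.map (· * g) (fun a b hab => by
    have hab' : b * a⁻¹ ∈ H := QuotientGroup.rightRel_apply.mp hab
    show QuotientGroup.rightRel H (a * g) (b * g)
    rw [QuotientGroup.rightRel_apply]
    simpa [mul_inv_rev, mul_assoc] using hab') x

/-- The simplicial metric `d_Y` on (the vertices of) the relative Cayley graph
`Y = Γ(G/H, A)`: the least length of a word in the generators leading from one coset
to the other. -/
noncomputable def dY {A G : Type*} [Group G] (π : A → G) (H : Subgroup G)
    (x y : Quotient (QuotientGroup.rightRel H)) : ℕ :=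
  sInf {n | ∃ w : List (A × Bool), w.length = n ∧ cosetMul H x (evalWord π w) = y}

/-- `g` is a shortest element of its right coset `Hg` with respect to the word length. -/
def ShortestInCoset {A G : Type*} [Group G] (π : A → G) (H : Subgroup G) (g : G) : Prop :=
  ∀ h ∈ H, wordLen π g ≤ wordLen π (h * g)

/-- The path in `Y = Γ(G/H,A)` starting at the coset `Hg` and reading the word `w`. -/
def cosetPath {A G : Type*} [Group G] (π : A → G) (H : Subgroup G) (g : G)
    (w : List (A × Bool)) : ℕ → Quotient (QuotientGroup.rightRel H) :=
  fun n => cosetMul H (rcoset H g) (evalWord π (w.take n))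

/-- The set-up of Section 4: a bigon `Θ` in `Y = Γ(G/H,A)` with near-geodesic sides
labelled `w` and `u` from `x₁ = Hg` to `x₂ = Hf`, where `g, f` are `d_X`-shortest in their
cosets, and `h₁, h₂ ∈ H` satisfy `h₁·g·w̄ = f = h₂·g·ū`. -/
def BigonSetup {A G : Type*} [Group G] [Fintype A] (π : A → G) (H : Subgroup G)
    (g f : G) (w u : List (A × Bool)) (h₁ h₂ : G) : Prop :=
  ShortestInCoset π H g ∧ ShortestInCoset π H f ∧
  h₁ ∈ H ∧ h₂ ∈ H ∧
  h₁ * (g * evalWord π w) = f ∧ h₂ * (g * evalWord π u) = f ∧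
  IsNearGeodesicPath (dY π H) (rcoset H g) (rcoset H f) (cosetPath π H g w) w.length ∧
  IsNearGeodesicPath (dY π H) (rcoset H g) (rcoset H f) (cosetPath π H g u) u.length

/-- The property of the constant `K₂ = K₂(H)` established in Lemma 4.2: in the bigon
set-up, any subsegment of `σ = [g, hg]` with midpoint the inscribed-triple point `c`
(at parameter `t_c = (1,hg)_g` along `σ`) which is contained in the closed
`δ`-neighbourhood of `α` or of `β` has length at most `K₂`. -/
def Lemma42Const {A G : Type*} [Group G] [Fintype A] (π : A → G) (H : Subgroup G)
    (δ : ℕ) (K₂ : ℝ) : Prop :=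
  ∀ (g f : G) (w u : List (A × Bool)) (h₁ h₂ : G),
    BigonSetup π H g f w u h₁ h₂ →
    ∀ (σ α β : ℕ → G),
      IsDiscGeodesic (dX π) g (h₁⁻¹ * h₂ * g) σ →
      IsDiscGeodesic (dX π) g (g * evalWord π w) α →
      IsDiscGeodesic (dX π) (h₁⁻¹ * h₂ * g) (g * evalWord π w) β →
      ∀ ρ : ℝ, 0 ≤ ρ →
        0 ≤ gromovProd (dX π) 1 (h₁⁻¹ * h₂ * g) g - ρ →
        gromovProd (dX π) 1 (h₁⁻¹ * h₂ * g) g + ρ ≤ (dX π g (h₁⁻¹ * h₂ * g) : ℝ) →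
        ((∀ i ≤ dX π g (h₁⁻¹ * h₂ * g),
            |(i : ℝ) - gromovProd (dX π) 1 (h₁⁻¹ * h₂ * g) g| ≤ ρ →
            ∃ j ≤ dX π g (g * evalWord π w), (dX π (σ i) (α j) : ℝ) ≤ δ) ∨
         (∀ i ≤ dX π g (h₁⁻¹ * h₂ * g),
            |(i : ℝ) - gromovProd (dX π) 1 (h₁⁻¹ * h₂ * g) g| ≤ ρ →
            ∃ j ≤ dX π (h₁⁻¹ * h₂ * g) (g * evalWord π w),
              (dX π (σ i) (β j) : ℝ) ≤ δ)) →
        2 * ρ ≤ K₂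

/-! ## The word metric -/

section WordMetric

variable {A G : Type*} [Group G] {π : A → G}

theorem evalWord_append (v w : List (A × Bool)) :
    evalWord π (v ++ w) = evalWord π v * evalWord π w := by
  simp [evalWord]

theorem exists_evalWord_inv (w : List (A × Bool)) :
    ∃ v : List (A × Bool), v.length = w.length ∧ evalWord π v = (evalWord π w)⁻¹ := by
  induction w with
  | nil => exact ⟨[], rfl, by simp [evalWord]⟩
  | cons p w ih =>
    obtain ⟨v, hlen, hv⟩ := ih
    refine ⟨v ++ [(p.1, !p.2)], by simp [hlen], ?_⟩
    rw [evalWord_append, hv]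
    rcases p with ⟨a, b⟩
    cases b <;> simp [evalWord]

theorem exists_evalWord_eq (hgen : Subgroup.closure (Set.range π) = ⊤) (g : G) :
    ∃ w, evalWord π w = g := by
  have hg : g ∈ Subgroup.closure (Set.range π) := hgen ▸ Subgroup.mem_top g
  induction hg using Subgroup.closure_induction with
  | mem x hx =>
    obtain ⟨a, rfl⟩ := hx
    exact ⟨[(a, true)], by simp [evalWord]⟩
  | one => exact ⟨[], by simp [evalWord]⟩
  | mul x y _ _ hx hy =>
    obtain ⟨v, rfl⟩ := hx
    obtain ⟨w, rfl⟩ := hy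
    exact ⟨v ++ w, evalWord_append v w⟩
  | inv x _ hx =>
    obtain ⟨v, rfl⟩ := hx
    obtain ⟨w, -, hw⟩ := exists_evalWord_inv (π := π) v
    exact ⟨w, hw⟩

theorem wordLen_evalWord_le (w : List (A × Bool)) : wordLen π (evalWord π w) ≤ w.length :=
  Nat.sInf_le ⟨w, rfl, rfl⟩

theorem exists_length_eq_wordLen (hgen : Subgroup.closure (Set.range π) = ⊤) (g : G) :
    ∃ w : List (A × Bool), w.length = wordLen π g ∧ evalWord π w = g := by
  obtain ⟨w, hw⟩ := exists_evalWord_eq hgen g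
  exact Nat.sInf_mem (s := {n | ∃ w : List (A × Bool), w.length = n ∧ evalWord π w = g})
    ⟨w.length, w, rfl, hw⟩

theorem wordLen_inv_le (hgen : Subgroup.closure (Set.range π) = ⊤) (g : G) :
    wordLen π g⁻¹ ≤ wordLen π g := by
  obtain ⟨w, hlen, rfl⟩ := exists_length_eq_wordLen hgen g
  obtain ⟨v, hv, hv'⟩ := exists_evalWord_inv (π := π) w
  rw [← hv', ← hlen, ← hv]
  exact wordLen_evalWord_le v

theorem wordLen_mul_le (hgen : Subgroup.closure (Set.range π) = ⊤) (g h : G) :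
    wordLen π (g * h) ≤ wordLen π g + wordLen π h := by
  obtain ⟨v, hv, hv'⟩ := exists_length_eq_wordLen hgen g
  obtain ⟨w, hw, hw'⟩ := exists_length_eq_wordLen hgen h
  rw [← hv, ← hw, ← List.length_append]
  conv_lhs => rw [← hv', ← hw', ← evalWord_append]
  exact wordLen_evalWord_le _

theorem dX_self (x : G) : dX π x x = 0 := by
  have := wordLen_evalWord_le (π := π) []
  simpa [dX, evalWord] using this

theorem dX_comm (hgen : Subgroup.closure (Set.range π) = ⊤) (x y : G) :
    dX π x y = dX π y x := by
  have key : ∀ x y : G, dX π x y ≤ dX π y x := fun x y => by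
    have := wordLen_inv_le hgen (y⁻¹ * x)
    simpa [dX] using this
  exact le_antisymm (key x y) (key y x)

theorem dX_triangle (hgen : Subgroup.closure (Set.range π) = ⊤) (x y z : G) :
    dX π x z ≤ dX π x y + dX π y z := by
  have := wordLen_mul_le hgen (x⁻¹ * y) (y⁻¹ * z)
  simpa [dX, mul_assoc] using this

theorem dX_mul_left (a x y : G) : dX π (a * x) (a * y) = dX π x y := by
  simp [dX, mul_assoc]

theorem dX_one_left (x : G) : dX π 1 x = wordLen π x := by simp [dX]

theorem dX_mul_right (x y : G) : dX π x (x * y) = wordLen π y := by simp [dX]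

theorem exists_isDiscGeodesic (hgen : Subgroup.closure (Set.range π) = ⊤) (x y : G) :
    ∃ γ, IsDiscGeodesic (dX π) x y γ := by
  obtain ⟨w, hlen, hw⟩ := exists_length_eq_wordLen hgen (x⁻¹ * y)
  change w.length = dX π x y at hlen
  set γ : ℕ → G := fun i => x * evalWord π (w.take i) with hγ
  have h0 : γ 0 = x := by simp [hγ, evalWord]
  have h1 : γ (dX π x y) = y := by simp [hγ, ← hlen, hw]
  have hle : ∀ i j, i ≤ j → dX π (γ i) (γ j) ≤ j - i := by
    intro i j hij
    have hsplit : w.take j = w.take i ++ (w.drop i).take (j - i) := by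
      rw [← List.take_add, Nat.add_sub_cancel' hij]
    simp only [hγ, hsplit, evalWord_append, ← mul_assoc, dX_mul_right]
    exact (wordLen_evalWord_le _).trans (List.length_take_le _ _)
  have heq : ∀ i j, i ≤ j → j ≤ dX π x y → dX π (γ i) (γ j) = j - i := by
    intro i j hij hj
    have a1 := hle 0 i (Nat.zero_le _)
    have a2 := hle i j hij
    have a3 := hle j _ hj
    rw [h0] at a1
    rw [h1] at a3
    have t1 := dX_triangle hgen x (γ i) y
    have t2 := dX_triangle hgen (γ i) (γ j) y
    omega
  refine ⟨γ, h0, h1, fun i j hi hj => ?_⟩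
  rcases le_total i j with hij | hij
  · rw [heq i j hij hj, Nat.dist_eq_sub_of_le hij]
  · rw [dX_comm hgen, heq j i hij hi, Nat.dist_eq_sub_of_le_right hij]

end WordMetric

/-! ## Discrete geodesics -/

section Geodesic

variable {X : Type*} {d : X → X → ℕ} {x y : X} {γ : ℕ → X}

theorem IsDiscGeodesic.dist_left (h : IsDiscGeodesic d x y γ) {i : ℕ} (hi : i ≤ d x y) :
    d x (γ i) = i := by
  have := h.2.2 0 i (Nat.zero_le _) hi
  rwa [h.1, Nat.dist_eq_sub_of_le (Nat.zero_le _)] at this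

theorem IsDiscGeodesic.dist_right (h : IsDiscGeodesic d x y γ) {i : ℕ} (hi : i ≤ d x y) :
    d (γ i) y = d x y - i := by
  have := h.2.2 i _ hi le_rfl
  rwa [h.2.1, Nat.dist_eq_sub_of_le hi] at this

theorem IsDiscGeodesic.reverse (h : IsDiscGeodesic d x y γ) (hd : d y x = d x y) :
    IsDiscGeodesic d y x (fun i => γ (d x y - i)) := by
  refine ⟨by simpa using h.2.1, by simpa [hd] using h.1, fun i j hi hj => ?_⟩
  rw [h.2.2 _ _ (Nat.sub_le _ _) (Nat.sub_le _ _)]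
  simp only [Nat.dist]
  omega

theorem DiscTrimTriangles.dist_le {δ : ℕ} (h : DiscTrimTriangles d δ) {x y z : X}
    {γ₁ γ₂ : ℕ → X} (h₁ : IsDiscGeodesic d z x γ₁) (h₂ : IsDiscGeodesic d z y γ₂) {i : ℕ}
    (hx : i ≤ d z x) (hy : i ≤ d z y) (hi : 2 * i + d x y ≤ d z x + d z y) :
    d (γ₁ i) (γ₂ i) ≤ δ := by
  refine h x y z γ₁ γ₂ h₁ h₂ i hx hy ?_
  have : (2 * i + d x y : ℝ) ≤ d z x + d z y := by exact_mod_cast hi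
  unfold gromovProd
  linarith

end Geodesic

/-! ## The simplicial metric on the relative Cayley graph -/

section CosetMetric

variable {A G : Type*} [Group G] {π : A → G} {H : Subgroup G}

theorem rcoset_eq_iff {x y : G} : rcoset H x = rcoset H y ↔ y * x⁻¹ ∈ H :=
  Quotient.eq.trans QuotientGroup.rightRel_apply

theorem dY_le_dX (hgen : Subgroup.closure (Set.range π) = ⊤) {k : G} (hk : k ∈ H) (x y : G) :
    dY π H (rcoset H x) (rcoset H y) ≤ dX π x (k * y) := by
  obtain ⟨w, hlen, hw⟩ := exists_length_eq_wordLen hgen (x⁻¹ * (k * y))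
  refine Nat.sInf_le ⟨w, hlen, ?_⟩
  change rcoset H (x * evalWord π w) = rcoset H y
  rw [rcoset_eq_iff, hw]
  simpa using H.inv_mem hk

theorem exists_dX_le_dY (hgen : Subgroup.closure (Set.range π) = ⊤) (x y : G) :
    ∃ k ∈ H, dX π x (k * y) ≤ dY π H (rcoset H x) (rcoset H y) := by
  obtain ⟨v, hv⟩ := exists_evalWord_eq hgen (x⁻¹ * y)
  obtain ⟨w, hlen, hw⟩ := Nat.sInf_mem
    (s := {n | ∃ w : List (A × Bool), w.length = n ∧
      cosetMul H (rcoset H x) (evalWord π w) = rcoset H y})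
    ⟨v.length, v, rfl, by
      change rcoset H (x * evalWord π v) = rcoset H y
      rw [hv, mul_inv_cancel_left]⟩
  change rcoset H (x * evalWord π w) = rcoset H y at hw
  rw [rcoset_eq_iff] at hw
  refine ⟨x * evalWord π w * y⁻¹, by simpa [mul_assoc] using H.inv_mem hw, ?_⟩
  rw [inv_mul_cancel_right, dX_mul_right]
  exact (wordLen_evalWord_le w).trans hlen.le

theorem dY_comm (hgen : Subgroup.closure (Set.range π) = ⊤)
    (x y : Quotient (QuotientGroup.rightRel H)) : dY π H x y = dY π H y x := by
  have key : ∀ x y, dY π H x y ≤ dY π H y x := by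
    refine fun x y => Quotient.inductionOn₂ x y fun a b => ?_
    obtain ⟨k, hk, hle⟩ := exists_dX_le_dY (H := H) hgen b a
    refine (dY_le_dX hgen (H.inv_mem hk) a b).trans (le_trans (le_of_eq ?_) hle)
    rw [dX_comm hgen, ← dX_mul_left k, mul_inv_cancel_left]
  exact le_antisymm (key x y) (key y x)

theorem dY_triangle (hgen : Subgroup.closure (Set.range π) = ⊤)
    (x y z : Quotient (QuotientGroup.rightRel H)) :
    dY π H x z ≤ dY π H x y + dY π H y z := by
  refine Quotient.inductionOn₃ x y z fun a b c => ?_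
  obtain ⟨k, hk, hle⟩ := exists_dX_le_dY (H := H) hgen a b
  obtain ⟨l, hl, hle'⟩ := exists_dX_le_dY (H := H) hgen b c
  refine (dY_le_dX hgen (H.mul_mem hk hl) a c).trans
    ((dX_triangle hgen a (k * b) _).trans (add_le_add hle ?_))
  rwa [mul_assoc, dX_mul_left]

theorem IsNearGeodesicPath.length_le (hgen : Subgroup.closure (Set.range π) = ⊤)
    {x y : Quotient (QuotientGroup.rightRel H)} {γ : ℕ → Quotient (QuotientGroup.rightRel H)}
    {n : ℕ} (h : IsNearGeodesicPath (dY π H) x y γ n) : n ≤ dY π H x y + 4 := by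
  obtain ⟨rfl, rfl, hpath, a, b, ha, hb, hab, hgeo⟩ := h
  have hself : ∀ i, dY π H (γ i) (γ i) = 0 := fun i =>
    Quotient.inductionOn (γ i) fun g => Nat.le_zero.mp <|
      (dY_le_dX hgen H.one_mem g g).trans (by rw [one_mul, dX_self])
  have h0 : dY π H (γ 0) (γ a) ≤ 1 := by
    interval_cases a
    · simp [hself]
    · exact hpath 0 (by omega)
  have h1 : dY π H (γ (n - b)) (γ n) ≤ 1 := by
    interval_cases b
    · simp [hself]
    · have := hpath (n - 1) (by omega)
      rwa [Nat.sub_add_cancel (by omega)] at this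
  have hm := hgeo a (n - b) le_rfl (by omega) (by omega)
  have t1 := dY_triangle hgen (γ a) (γ 0) (γ (n - b))
  have t2 := dY_triangle hgen (γ 0) (γ n) (γ (n - b))
  rw [dY_comm hgen (γ a) (γ 0)] at t1
  rw [dY_comm hgen (γ n) (γ (n - b))] at t2
  omega

/-- A geodesic of `X` that spells an arc with near-geodesic image in `Y` leaves every
neighbourhood of `H` within a bounded distance of its start. -/
theorem IsNearGeodesicPath.index_le_of_near (hgen : Subgroup.closure (Set.range π) = ⊤)
    {g f k k' : G} {w : List (A × Bool)} (hk : k ∈ H) (hk' : k' ∈ H)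
    (hf : rcoset H f = rcoset H (g * evalWord π w))
    (hw : IsNearGeodesicPath (dY π H) (rcoset H g) (rcoset H f) (cosetPath π H g w) w.length)
    {α : ℕ → G} (hα : IsDiscGeodesic (dX π) (k * g) (k * (g * evalWord π w)) α)
    {i D : ℕ} (hi : i ≤ dX π (k * g) (k * (g * evalWord π w))) (hD : dX π (α i) k' ≤ D) :
    i ≤ wordLen π g + D + 4 := by
  have hlen := hw.length_le hgen
  rw [hf] at hlen
  have h1 := dY_le_dX hgen (H.mul_mem (H.inv_mem hk') hk) g (g * evalWord π w)
  have h2 := hα.dist_right hi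
  have h3 : dX π (k * g) (k * (g * evalWord π w)) ≤ w.length := by
    rw [dX_mul_left, dX_mul_right]
    exact wordLen_evalWord_le w
  have h4 : dX π g (k'⁻¹ * k * (g * evalWord π w)) ≤
      dX π g 1 + dX π 1 (k'⁻¹ * k * (g * evalWord π w)) := dX_triangle hgen _ _ _
  have h5 : dX π 1 (k'⁻¹ * k * (g * evalWord π w)) = dX π k' (k * (g * evalWord π w)) := by
    rw [← dX_mul_left k']
    simp [mul_assoc]
  have h6 := dX_triangle hgen k' (α i) (k * (g * evalWord π w))
  rw [dX_comm hgen g 1, dX_one_left] at h4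
  rw [dX_comm hgen k' (α i)] at h6
  omega

end CosetMetric

/-! ## Hyperbolicity and quasiconvexity -/

section Hyperbolic

variable {A G : Type*} [Group G] {π : A → G} {δ E : ℕ} {H : Subgroup G}

theorem dX_four_point (hgen : Subgroup.closure (Set.range π) = ⊤)
    (htrim : DiscTrimTriangles (dX π) δ) (x y z w : G) :
    dX π x z + dX π w y ≤
      max (dX π w x + dX π y z) (dX π w z + dX π x y) + (2 * δ + 1) := by
  obtain ⟨γx, hx⟩ := exists_isDiscGeodesic hgen w x
  obtain ⟨γy, hy⟩ := exists_isDiscGeodesic hgen w y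
  obtain ⟨γz, hz⟩ := exists_isDiscGeodesic hgen w z
  have c1 := dX_comm hgen x y
  have c2 := dX_comm hgen y z
  have t1 := dX_triangle hgen w x y
  have t2 := dX_triangle hgen w y x
  have t3 := dX_triangle hgen w y z
  have t4 := dX_triangle hgen w z y
  obtain ⟨t, ht⟩ : ∃ t, t = min ((dX π w x + dX π w y - dX π x y) / 2)
      ((dX π w y + dX π w z - dX π y z) / 2) := ⟨_, rfl⟩
  have s1 := dX_triangle hgen x w y
  have s2 := dX_triangle hgen y w z
  rw [dX_comm hgen x w] at s1
  rw [dX_comm hgen y w] at s2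
  have d1 := htrim.dist_le hx hy (i := t) (by omega) (by omega) (by omega)
  have d2 := htrim.dist_le hy hz (i := t) (by omega) (by omega) (by omega)
  have e1 := hx.dist_right (i := t) (by omega)
  have e2 := hz.dist_right (i := t) (by omega)
  have u1 := dX_triangle hgen x (γx t) z
  have u2 := dX_triangle hgen (γx t) (γy t) z
  have u3 := dX_triangle hgen (γy t) (γz t) z
  rw [dX_comm hgen x (γx t)] at u1
  omega

theorem ShortestInCoset.add_wordLen_le (hgen : Subgroup.closure (Set.range π) = ⊤)
    (htrim : DiscTrimTriangles (dX π) δ) (hqc : DiscQuasiconvex (dX π) (H : Set G) (E : ℝ))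
    {g : G} (hg : ShortestInCoset π H g) {h : G} (hh : h ∈ H) :
    wordLen π h + wordLen π g ≤ wordLen π (h * g) + (2 * (δ + E) + 1) := by
  obtain ⟨γ₁, h₁⟩ := exists_isDiscGeodesic hgen h 1
  obtain ⟨γ₂, h₂⟩ := exists_isDiscGeodesic hgen h (h * g)
  have e1 : dX π h 1 = wordLen π h := by rw [dX_comm hgen, dX_one_left]
  have e2 : dX π h (h * g) = wordLen π g := dX_mul_right h g
  have e3 : dX π 1 (h * g) = wordLen π (h * g) := dX_one_left _
  have t1 := dX_triangle hgen h 1 (h * g)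
  have t2 := dX_triangle hgen h (h * g) 1
  have t3 := dX_triangle hgen 1 h (h * g)
  have c1 := dX_comm hgen 1 h
  have c2 := dX_comm hgen 1 (h * g)
  obtain ⟨t, ht⟩ : ∃ t, t = (wordLen π h + wordLen π g - wordLen π (h * g)) / 2 := ⟨_, rfl⟩
  have d1 := htrim.dist_le h₁ h₂ (i := t) (by omega) (by omega) (by omega)
  obtain ⟨k, hk, hkE⟩ := hqc h 1 γ₁ hh H.one_mem h₁ t (by omega)
  have hkE' : dX π (γ₁ t) k ≤ E := by exact_mod_cast hkE
  have d2 := h₂.dist_right (i := t) (by omega)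
  have hmin := hg (k⁻¹ * h) (H.mul_mem (H.inv_mem hk) hh)
  have e4 : wordLen π (k⁻¹ * h * g) = dX π k (h * g) := by simp [dX, mul_assoc]
  have u1 := dX_triangle hgen k (γ₁ t) (h * g)
  have u2 := dX_triangle hgen (γ₁ t) (γ₂ t) (h * g)
  rw [dX_comm hgen k (γ₁ t)] at u1
  omega

theorem exists_mem_dX_le (hgen : Subgroup.closure (Set.range π) = ⊤)
    (htrim : DiscTrimTriangles (dX π) δ) (hqc : DiscQuasiconvex (dX π) (H : Set G) (E : ℝ))
    {g h : G} (hh : h ∈ H) {σ : ℕ → G} (hσ : IsDiscGeodesic (dX π) g (h * g) σ)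
    {i : ℕ} (hi : i ≤ dX π g (h * g)) :
    ∃ k ∈ H, dX π (σ i) k ≤ 4 * wordLen π g + (2 * δ + 1) + E := by
  have e0 : dX π g 1 = wordLen π g := by rw [dX_comm hgen, dX_one_left]
  have e1 : dX π 1 g = wordLen π g := dX_one_left g
  have e2 : dX π h (h * g) = wordLen π g := dX_mul_right h g
  have e2' := dX_comm hgen h (h * g)
  have l1 := hσ.dist_left hi
  have l2 := hσ.dist_right hi
  have t1 := dX_triangle hgen 1 g (σ i)
  have t2 := dX_triangle hgen (σ i) (h * g) h
  have t3 := dX_triangle hgen g 1 (h * g)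
  have t4 := dX_triangle hgen 1 h (h * g)
  by_cases hlt : dX π 1 (σ i) ≤ dX π 1 h
  · obtain ⟨η, hη⟩ := exists_isDiscGeodesic hgen 1 h
    obtain ⟨k, hk, hkE⟩ := hqc 1 h η H.one_mem hh hη _ hlt
    have hkE' : dX π (η (dX π 1 (σ i))) k ≤ E := by exact_mod_cast hkE
    have m1 := hη.dist_left hlt
    have m2 := hη.dist_right hlt
    have fp := dX_four_point hgen htrim (σ i) h (η (dX π 1 (σ i))) 1
    have c := dX_comm hgen h (η (dX π 1 (σ i)))
    have u := dX_triangle hgen (σ i) (η (dX π 1 (σ i))) k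
    exact ⟨k, hk, by omega⟩
  · exact ⟨h, hh, by omega⟩

/-- A short initial part `[g, c]` of `σ` forces either `σ` or the shortest coset
representative `g` to be short. -/
theorem ShortestInCoset.dX_le_or_wordLen_le (hgen : Subgroup.closure (Set.range π) = ⊤)
    (htrim : DiscTrimTriangles (dX π) δ) (hqc : DiscQuasiconvex (dX π) (H : Set G) (E : ℝ))
    {g : G} (hg : ShortestInCoset π H g) {h : G} (hh : h ∈ H) {K : ℕ}
    (hK : wordLen π g + dX π g (h * g) ≤ wordLen π (h * g) + K) :
    dX π g (h * g) ≤ K + 2 * (2 * (δ + E) + 1) + (2 * δ + 1) ∨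
      wordLen π g ≤ K + 2 * (2 * (δ + E) + 1) + (2 * δ + 1) := by
  have a1 := hg.add_wordLen_le hgen htrim hqc hh
  have a2 := hg.add_wordLen_le hgen htrim hqc (H.inv_mem hh)
  have e1 : wordLen π (h⁻¹ * g) = dX π h g := rfl
  have e2 : wordLen π h⁻¹ = wordLen π h := by
    have := dX_comm hgen h 1
    simpa [dX] using this
  have e3 : dX π h (h * g) = wordLen π g := dX_mul_right h g
  have e4 : dX π 1 g = wordLen π g := dX_one_left g
  have e5 : dX π 1 h = wordLen π h := dX_one_left h
  have e6 : dX π 1 (h * g) = wordLen π (h * g) := dX_one_left _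
  have c1 := dX_comm hgen h g
  have fp := dX_four_point hgen htrim g (h * g) h 1
  have c2 := dX_comm hgen h (h * g)
  have t := wordLen_mul_le hgen h g
  omega

end Hyperbolic

section Bigon

variable {A G : Type*} [Group G] [Fintype A] {π : A → G} {δ E : ℕ} {H : Subgroup G}
  {g f : G} {w u : List (A × Bool)} {h₁ h₂ : G}

theorem BigonSetup.mem (h : BigonSetup π H g f w u h₁ h₂) : h₁⁻¹ * h₂ ∈ H :=
  H.mul_mem (H.inv_mem h.2.2.1) h.2.2.2.1

theorem BigonSetup.mul_evalWord_eq (h : BigonSetup π H g f w u h₁ h₂) :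
    h₁⁻¹ * h₂ * (g * evalWord π u) = g * evalWord π w := by
  obtain ⟨-, -, -, -, e1, e2, -, -⟩ := h
  rw [mul_assoc, e2, ← e1, inv_mul_cancel_left]

/-- The length of `σ` is bounded linearly in the length of the coset representative `g`. -/
theorem BigonSetup.dX_le_mul_wordLen (hgen : Subgroup.closure (Set.range π) = ⊤)
    (htrim : DiscTrimTriangles (dX π) δ) (hqc : DiscQuasiconvex (dX π) (H : Set G) (E : ℝ))
    (h : BigonSetup π H g f w u h₁ h₂) :
    dX π g (h₁⁻¹ * h₂ * g) ≤ 2 * (5 * wordLen π g + 3 * δ + E + 5) + 1 := by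
  have hmem := h.mem
  have hf' := h.mul_evalWord_eq
  obtain ⟨-, -, m1, m2, e1, e2, hw, hu⟩ := h
  have r1 : rcoset H f = rcoset H (g * evalWord π w) := by
    rw [rcoset_eq_iff, ← e1, mul_inv_rev, mul_inv_cancel_left]
    exact H.inv_mem m1
  have r2 : rcoset H f = rcoset H (g * evalWord π u) := by
    rw [rcoset_eq_iff, ← e2, mul_inv_rev, mul_inv_cancel_left]
    exact H.inv_mem m2
  generalize h₁⁻¹ * h₂ = k at *
  obtain ⟨σ, hσ⟩ := exists_isDiscGeodesic hgen g (k * g)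
  obtain ⟨α, hα⟩ := exists_isDiscGeodesic hgen g (g * evalWord π w)
  obtain ⟨β, hβ⟩ := exists_isDiscGeodesic hgen (k * g) (g * evalWord π w)
  have hσ' := hσ.reverse (dX_comm hgen _ _)
  have t1 := dX_triangle hgen g (k * g) (g * evalWord π w)
  have t2 := dX_triangle hgen g (g * evalWord π w) (k * g)
  have t3 := dX_triangle hgen (k * g) g (g * evalWord π w)
  have c1 := dX_comm hgen g (k * g)
  have c2 := dX_comm hgen (k * g) (g * evalWord π w)
  obtain ⟨i, hi⟩ : ∃ i, i = (dX π g (k * g) + dX π g (g * evalWord π w) -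
      dX π (k * g) (g * evalWord π w)) / 2 := ⟨_, rfl⟩
  obtain ⟨j, hj⟩ : ∃ j, j = (dX π g (k * g) + dX π (k * g) (g * evalWord π w) -
      dX π g (g * evalWord π w)) / 2 := ⟨_, rfl⟩
  have d1 := htrim.dist_le hσ hα (i := i) (by omega) (by omega) (by omega)
  have d2 := htrim.dist_le hσ' hβ (i := j) (by omega) (by omega) (by omega)
  obtain ⟨a, ha, ha'⟩ := exists_mem_dX_le hgen htrim hqc hmem hσ (i := i) (by omega)
  obtain ⟨b, hb, hb'⟩ := exists_mem_dX_le hgen htrim hqc hmem hσ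
    (i := dX π g (k * g) - j) (by omega)
  have u1 := dX_triangle hgen (α i) (σ i) a
  have u2 := dX_triangle hgen (β j) (σ (dX π g (k * g) - j)) b
  rw [dX_comm hgen (α i) (σ i)] at u1
  rw [dX_comm hgen (β j) (σ _)] at u2
  have b1 := hw.index_le_of_near hgen H.one_mem ha r1 (α := α) (i := i)
    (D := 4 * wordLen π g + (2 * δ + 1) + E + δ) (by simpa using hα)
    (by simp only [one_mul]; omega) (by omega)
  have b2 := hu.index_le_of_near hgen hmem hb r2 (α := β) (i := j)
    (D := 4 * wordLen π g + (2 * δ + 1) + E + δ) (by rw [hf']; exact hβ)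
    (by rw [hf']; omega) (by omega)
  omega

/-- If the two inscribed points on `σ` are further than `K₂` apart, then `c` lies within
`K₂ / 2` of an endpoint of `σ`. -/
theorem Lemma42Const.gromovProd_le_or (hgen : Subgroup.closure (Set.range π) = ⊤)
    (htrim : DiscTrimTriangles (dX π) δ) {K₂ : ℝ} (hK₂pos : 0 < K₂)
    (hK₂ : Lemma42Const π H δ K₂) (h : BigonSetup π H g f w u h₁ h₂)
    (hfar : K₂ < |gromovProd (dX π) (h₁⁻¹ * h₂ * g) (g * evalWord π w) g -
      gromovProd (dX π) 1 (h₁⁻¹ * h₂ * g) g|) :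
    2 * gromovProd (dX π) 1 (h₁⁻¹ * h₂ * g) g ≤ K₂ ∨
      2 * (dX π g (h₁⁻¹ * h₂ * g) - gromovProd (dX π) 1 (h₁⁻¹ * h₂ * g) g) ≤ K₂ := by
  obtain ⟨σ, hσ⟩ := exists_isDiscGeodesic hgen g (h₁⁻¹ * h₂ * g)
  obtain ⟨α, hα⟩ := exists_isDiscGeodesic hgen g (g * evalWord π w)
  obtain ⟨β, hβ⟩ := exists_isDiscGeodesic hgen (h₁⁻¹ * h₂ * g) (g * evalWord π w)
  have key := hK₂ g f w u h₁ h₂ h σ α β hσ hα hβ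
  generalize h₁⁻¹ * h₂ * g = q at *
  generalize g * evalWord π w = f' at *
  have hσ' := hσ.reverse (dX_comm hgen _ _)
  have c1 := dX_comm hgen g q
  have c2 := dX_comm hgen q f'
  have t1 := dX_triangle hgen g q f'
  have t2 := dX_triangle hgen g f' q
  have t3 := dX_triangle hgen q g f'
  have htp : 2 * gromovProd (dX π) q f' g = dX π g q + dX π g f' - dX π q f' := by
    unfold gromovProd
    ring
  generalize gromovProd (dX π) q f' g = tp at *
  have hc0 : 0 ≤ gromovProd (dX π) 1 q g := by
    have : (dX π 1 q : ℝ) ≤ dX π g 1 + dX π g q := by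
      rw [dX_comm hgen g 1]
      exact_mod_cast dX_triangle hgen 1 g q
    unfold gromovProd
    linarith
  have hc1 : gromovProd (dX π) 1 q g ≤ dX π g q := by
    have : (dX π g 1 : ℝ) ≤ dX π g q + dX π 1 q := by
      rw [dX_comm hgen 1 q]
      exact_mod_cast dX_triangle hgen g q 1
    unfold gromovProd
    linarith
  generalize gromovProd (dX π) 1 q g = tc at *
  by_contra! hcon
  obtain ⟨ρ, hρ⟩ : ∃ ρ, ρ = min |tp - tc| (min tc (dX π g q - tc)) := ⟨_, rfl⟩
  have r1 : ρ ≤ |tp - tc| := hρ ▸ min_le_left _ _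
  have r2 : ρ ≤ tc := hρ ▸ (min_le_right _ _).trans (min_le_left _ _)
  have r3 : ρ ≤ dX π g q - tc := hρ ▸ (min_le_right _ _).trans (min_le_right _ _)
  have r4 : K₂ / 2 < ρ := by
    rw [hρ]
    refine lt_min (by linarith) (lt_min (by linarith) (by linarith))
  have := key ρ (by linarith) (by linarith) (by linarith) ?_
  · linarith
  rcases le_total tc tp with hle | hle
  · left
    intro i hi hic
    rw [abs_of_nonneg (by linarith)] at r1
    have hi' : (i : ℝ) ≤ tp := by linarith [(abs_le.mp hic).2]
    have hn : 2 * i + dX π q f' ≤ dX π g q + dX π g f' := by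
      have : (2 * i + dX π q f' : ℝ) ≤ dX π g q + dX π g f' := by linarith
      exact_mod_cast this
    have hif : i ≤ dX π g f' := by omega
    exact ⟨i, hif, by exact_mod_cast htrim.dist_le hσ hα hi hif hn⟩
  · right
    intro i hi hic
    rw [abs_of_nonpos (by linarith)] at r1
    have hi' : tp ≤ (i : ℝ) := by linarith [(abs_le.mp hic).1]
    have hn : dX π g q + dX π g f' ≤ 2 * i + dX π q f' := by
      have : (dX π g q + dX π g f' : ℝ) ≤ 2 * i + dX π q f' := by linarith
      exact_mod_cast this
    have hif : dX π g q - i ≤ dX π q f' := by omega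
    have := htrim.dist_le hσ' hβ (i := dX π g q - i) (by omega) hif (by omega)
    rw [Nat.sub_sub_self hi] at this
    exact ⟨_, hif, by exact_mod_cast this⟩

end Bigon

/-- **Lemma 4.3.** In the bigon set-up (with `h = h₁⁻¹h₂`, `f' = g·w̄`, geodesics
`σ = [g,hg]`, `α = [g,f']`, `β = [hg,f']`), let `c` be the inscribed-triple point of the
triangle `[1,g] ∪ σ ∪ [1,hg]` on `σ` (at parameter `t_c = (1,hg)_g` along `σ`) and let `p`
be the inscribed-triple point of the triangle `Δ₂ = σ ∪ α ∪ β` on `σ` (at parameter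
`t_p = (hg, f')_g` along `σ`), and let `K₂ = K₂(H)` be the constant of Lemma 4.2.  Then
there is an integer constant `K₃ = K₃(H) > 0` such that either `d_X(g, hg) ≤ K₃` or
`d_X(p, c) = |t_p − t_c| ≤ K₂`. -/
theorem inscribed_points_close_or_sigma_short
    {A G : Type*} [Group G] [Fintype A] (π : A → G)
    (hgen : Subgroup.closure (Set.range π) = ⊤)
    (δ : ℕ) (hδ : 10 ≤ δ) (htrim : DiscTrimTriangles (dX π) δ)
    (H : Subgroup G) (E : ℕ) (hqc : DiscQuasiconvex (dX π) (H : Set G) (E : ℝ))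
    (K₂ : ℝ) (hK₂pos : 0 < K₂) (hK₂ : Lemma42Const π H δ K₂) :
    ∃ K₃ : ℕ, 0 < K₃ ∧
      ∀ (g f : G) (w u : List (A × Bool)) (h₁ h₂ : G),
        BigonSetup π H g f w u h₁ h₂ →
        (dX π g (h₁⁻¹ * h₂ * g) ≤ K₃) ∨
        |gromovProd (dX π) (h₁⁻¹ * h₂ * g) (g * evalWord π w) g -
            gromovProd (dX π) 1 (h₁⁻¹ * h₂ * g) g| ≤ K₂ := by
  obtain ⟨K, hK⟩ := exists_nat_ge K₂
  obtain ⟨M, hM⟩ : ∃ M, M = K + 2 * (2 * (δ + E) + 1) + (2 * δ + 1) := ⟨_, rfl⟩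
  refine ⟨2 * (5 * M + 3 * δ + E + 5) + 1, by omega, fun g f w u h₁ h₂ h => ?_⟩
  rw [or_iff_not_imp_right]
  intro hfar
  have hg := h.1
  have hbound := h.dX_le_mul_wordLen hgen htrim hqc
  have hgmin := hg _ h.mem
  have htc : 2 * gromovProd (dX π) 1 (h₁⁻¹ * h₂ * g) g =
      wordLen π g + dX π g (h₁⁻¹ * h₂ * g) - wordLen π (h₁⁻¹ * h₂ * g) := by
    rw [gromovProd, dX_comm hgen g 1, dX_one_left, dX_one_left]
    ring
  rcases hK₂.gromovProd_le_or hgen htrim hK₂pos h (not_le.mp hfar) with hc | hc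
  · have hn : wordLen π g + dX π g (h₁⁻¹ * h₂ * g) ≤ wordLen π (h₁⁻¹ * h₂ * g) + K := by
      have : (wordLen π g + dX π g (h₁⁻¹ * h₂ * g) : ℝ) ≤
          wordLen π (h₁⁻¹ * h₂ * g) + K := by linarith
      exact_mod_cast this
    rcases hg.dX_le_or_wordLen_le hgen htrim hqc h.mem hn with h' | h' <;> omega
  · have hn : dX π g (h₁⁻¹ * h₂ * g) ≤ K := by
      have h0 : (wordLen π g : ℝ) ≤ wordLen π (h₁⁻¹ * h₂ * g) := by exact_mod_cast hgmin
      have : (dX π g (h₁⁻¹ * h₂ * g) : ℝ) ≤ K := by linarith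
      exact_mod_cast this
    omega
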